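/- Let m, n ∈ ℕ with m ≥ 2 and n ≥ 2 both even. Then the Tornheim double series satisfies T(m,0,n) = ζ(m) ζ(n) − (1/2) ζ(m+n) + (−1)^{⌊(m+n)/2⌋} ((2π)^{m+n−1}/(m! n!)) · ( m·I_AB(m−1,n) + n·I_AB(m,n−1) ). -/

import Mathlib

open Real MeasureTheory

/-- Hurwitz zeta as a real-valued function of real arguments. -/
noncomputable def hzeta (z q : ℝ) : ℝ := (HurwitzZeta.hurwitzZeta (q : UnitAddCircle) (z : ℂ)).re

/-- Riemann zeta as a real-valued function of a real argument. -/
noncomputable def rzeta (s : ℝ) : ℝ := (riemannZeta (s : ℂ)).re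

/-- Tornheim double series. -/
noncomputable def T (a b c : ℝ) : ℝ :=
  ∑' r : ℕ+, ∑' s : ℕ+, 1 / ((r : ℝ) ^ a * (s : ℝ) ^ b * ((r : ℝ) + (s : ℝ)) ^ c)

/-- Bernoulli polynomial evaluated at a real. -/
noncomputable def B (k : ℕ) (q : ℝ) : ℝ := Polynomial.aeval q (Polynomial.bernoulli k)

/-- The Bernoulli function `A_k(q) = k ζ'(1-k, q)`. -/
noncomputable def A (k : ℕ) (q : ℝ) : ℝ :=
  k * (deriv (fun z : ℂ => HurwitzZeta.hurwitzZeta (q : UnitAddCircle) z) (1 - (k : ℂ))).re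

/-- The kernel `K(q) = log sin (π q)`. -/
noncomputable def K (q : ℝ) : ℝ := Real.log (Real.sin (π * q))

noncomputable def I_AB (k l : ℕ) : ℝ := (1 / π) * ∫ q in (0:ℝ)..1, A k q * B l q * K q

noncomputable def I_BB (k l : ℕ) : ℝ := ∫ q in (0:ℝ)..1, B k q * B l q * K q

noncomputable def I_AA (k l : ℕ) : ℝ := (1 / π ^ 2) * ∫ q in (0:ℝ)..1, A k q * A l q * K q

noncomputable def J_AA (k l : ℕ) : ℝ := (1 / π ^ 2) * ∫ q in (0:ℝ)..1, A k q * A l (1 - q) * K q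

section Auxiliary

open Filter Topology

theorem norm_sum_exp_le {q : ℝ} (hq : q ∈ Set.Ioo (0:ℝ) 1) (N : ℕ) :
    ‖∑ j ∈ Finset.range N, Complex.exp (2 * π * Complex.I * q * ((j:ℂ) + 1))‖ ≤
      √N / √(Real.sin (π * q)) := by
  have hs : 0 < Real.sin (π * q) := Real.sin_pos_of_pos_of_lt_pi (by nlinarith [hq.1, pi_pos])
    (by nlinarith [hq.2, pi_pos])
  set e : ℂ := Complex.exp (Complex.I * ((2 * π * q : ℝ) : ℂ)) with he
  have hterm (j : ℕ) : Complex.exp (2 * π * Complex.I * q * ((j:ℂ) + 1)) = e ^ j * e := by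
    rw [← pow_succ, he, ← Complex.exp_nat_mul]; congr 1; push_cast; ring
  have hne : ‖e‖ = 1 := by rw [he, Complex.norm_exp_I_mul_ofReal]
  have he1 : ‖e - 1‖ = 2 * Real.sin (π * q) := by
    rw [he, Complex.norm_exp_I_mul_ofReal_sub_one, show 2 * π * q / 2 = π * q by ring,
      Real.norm_of_nonneg (by positivity)]
  simp_rw [hterm]
  rw [← Finset.sum_mul, norm_mul, hne, mul_one]
  set x := ‖∑ j ∈ Finset.range N, e ^ j‖ with hx
  have h1 : x ≤ N := by
    refine (norm_sum_le _ _).trans ?_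
    simp [hne]
  have h2 : x * Real.sin (π * q) ≤ 1 := by
    have := congrArg norm (geom_sum_mul e N)
    rw [norm_mul, he1] at this
    have h3 : ‖e ^ N - 1‖ ≤ 2 := by
      refine (norm_sub_le _ _).trans ?_
      simp [hne]; norm_num
    nlinarith
  rw [← Real.sqrt_div (by positivity)]
  apply Real.le_sqrt_of_sq_le
  rw [le_div_iff₀ hs]
  have : 0 ≤ x := norm_nonneg _
  nlinarith

theorem norm_cpow_neg_sub_le {s : ℂ} (hs : 0 < s.re) {x : ℝ} (hx : 0 < x) :
    ‖((x + 1 : ℝ) : ℂ) ^ (-s) - (x : ℂ) ^ (-s)‖ ≤ ‖s‖ * x ^ (-s.re - 1) := by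
  have hs0 : s ≠ 0 := by rintro rfl; simp at hs
  have key := Convex.norm_image_sub_le_of_norm_hasDerivWithin_le
    (f := fun y : ℝ => (y : ℂ) ^ (-s)) (f' := fun y : ℝ => -s * (y : ℂ) ^ (-s - 1))
    (C := ‖s‖ * x ^ (-s.re - 1)) (s := Set.Icc x (x + 1)) (x := x) (y := x + 1)
    (fun y hy => by
      have hy0 : y ≠ 0 := (hx.trans_le hy.1).ne'
      exact (hasDerivAt_ofReal_cpow_const (x := y) hy0 (r := -s)
        (neg_ne_zero.mpr hs0)).hasDerivWithinAt)
    (fun y hy => by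
      have hy0 : 0 < y := hx.trans_le hy.1
      rw [norm_mul, norm_neg, Complex.norm_cpow_eq_rpow_re_of_pos hy0]
      gcongr ?_ * ?_
      simp only [Complex.sub_re, Complex.neg_re, Complex.one_re]
      exact Real.rpow_le_rpow_of_nonpos hx hy.1 (by linarith))
    (convex_Icc _ _) (by simp) (by simp)
  simpa using key

theorem sum_exp_mul_cpow_eq (q : ℝ) (s : ℂ) (N : ℕ) :
    ∑ j ∈ Finset.range (N + 1), Complex.exp (2 * π * Complex.I * q * ((j:ℂ) + 1)) *
      ((j : ℂ) + 1) ^ (-s) =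
    ((N : ℂ) + 1) ^ (-s) *
      ∑ j ∈ Finset.range (N + 1), Complex.exp (2 * π * Complex.I * q * ((j:ℂ) + 1)) -
    ∑ i ∈ Finset.range N, (((i : ℂ) + 1 + 1) ^ (-s) - ((i : ℂ) + 1) ^ (-s)) *
      ∑ j ∈ Finset.range (i + 1), Complex.exp (2 * π * Complex.I * q * ((j:ℂ) + 1)) := by
  have := Finset.sum_range_by_parts (fun j : ℕ => ((j : ℂ) + 1) ^ (-s))
    (fun j : ℕ => Complex.exp (2 * π * Complex.I * q * ((j:ℂ) + 1))) (N + 1)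
  simp only [smul_eq_mul, Nat.add_sub_cancel] at this
  push_cast at this
  rw [← this]
  exact Finset.sum_congr rfl fun _ _ => mul_comm _ _

theorem norm_term_le {q : ℝ} (hq : q ∈ Set.Ioo (0:ℝ) 1) {s : ℂ} (hs : 3 / 4 < s.re) {R : ℝ}
    (hR : ‖s‖ ≤ R) (i : ℕ) :
    ‖(((i : ℂ) + 1 + 1) ^ (-s) - ((i : ℂ) + 1) ^ (-s)) *
      ∑ j ∈ Finset.range (i + 1), Complex.exp (2 * π * Complex.I * q * ((j:ℂ) + 1))‖ ≤
      R / √(Real.sin (π * q)) * ((i : ℝ) + 1) ^ (-(5 / 4) : ℝ) := by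
  have h1 := norm_sum_exp_le hq (i + 1)
  have hi : (0 : ℝ) < (i : ℝ) + 1 := by positivity
  have h2 := norm_cpow_neg_sub_le (s := s) (by linarith) hi
  push_cast at h1 h2
  rw [norm_mul]
  have h3 : ((i : ℝ) + 1) ^ (-s.re - 1) ≤ ((i : ℝ) + 1) ^ (-(7 / 4) : ℝ) :=
    Real.rpow_le_rpow_of_exponent_le (by simp) (by linarith)
  have hR0 : 0 ≤ R := (norm_nonneg s).trans hR
  calc _ ≤ (‖s‖ * ((i : ℝ) + 1) ^ (-s.re - 1)) * (√((i : ℝ) + 1) / √(Real.sin (π * q))) := by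
        gcongr
    _ ≤ (R * ((i : ℝ) + 1) ^ (-(7 / 4) : ℝ)) * (√((i : ℝ) + 1) / √(Real.sin (π * q))) := by
        gcongr
    _ = R / √(Real.sin (π * q)) * (((i : ℝ) + 1) ^ (-(7 / 4) : ℝ) * ((i : ℝ) + 1) ^ (1 / 2 : ℝ)) := by
        rw [Real.sqrt_eq_rpow ((i : ℝ) + 1)]; ring
    _ = _ := by
        rw [← Real.rpow_add hi]; norm_num

theorem norm_boundary_term_le {q : ℝ} (hq : q ∈ Set.Ioo (0:ℝ) 1) {s : ℂ} (hs : 3 / 4 < s.re)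
    (N : ℕ) :
    ‖((N : ℂ) + 1) ^ (-s) *
      ∑ j ∈ Finset.range (N + 1), Complex.exp (2 * π * Complex.I * q * ((j:ℂ) + 1))‖ ≤
      1 / √(Real.sin (π * q)) * ((N : ℝ) + 1) ^ (-(1 / 4) : ℝ) := by
  have h1 := norm_sum_exp_le hq (N + 1)
  have hi : (0 : ℝ) < (N : ℝ) + 1 := by positivity
  push_cast at h1
  have h2 : ‖((N : ℂ) + 1) ^ (-s)‖ ≤ ((N : ℝ) + 1) ^ (-(3 / 4) : ℝ) := by
    have := Complex.norm_cpow_eq_rpow_re_of_pos hi (-s)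
    push_cast at this
    rw [this]
    exact Real.rpow_le_rpow_of_exponent_le (by simp) (by simp; linarith)
  rw [norm_mul]
  calc _ ≤ ((N : ℝ) + 1) ^ (-(3 / 4) : ℝ) * (√((N : ℝ) + 1) / √(Real.sin (π * q))) := by
        gcongr
    _ = 1 / √(Real.sin (π * q)) * (((N : ℝ) + 1) ^ (-(3 / 4) : ℝ) * ((N : ℝ) + 1) ^ (1 / 2 : ℝ)) := by
        rw [Real.sqrt_eq_rpow ((N : ℝ) + 1)]; ring
    _ = _ := by
        rw [← Real.rpow_add hi]; norm_num

theorem summable_add_one_rpow : Summable fun i : ℕ => ((i : ℝ) + 1) ^ (-(5 / 4) : ℝ) := by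
  have := (summable_nat_add_iff 1).mpr
    (Real.summable_nat_rpow (p := -(5 / 4)).mpr (by norm_num))
  simpa using this

theorem tendsto_sum_exp_tsum {q : ℝ} (hq : q ∈ Set.Ioo (0:ℝ) 1) {s : ℂ} (hs : 3 / 4 < s.re) :
    Tendsto (fun N : ℕ => ∑ j ∈ Finset.range N,
      Complex.exp (2 * π * Complex.I * q * ((j:ℂ) + 1)) * ((j : ℂ) + 1) ^ (-s)) atTop
      (𝓝 (-∑' i : ℕ, (((i : ℂ) + 1 + 1) ^ (-s) - ((i : ℂ) + 1) ^ (-s)) *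
      ∑ j ∈ Finset.range (i + 1), Complex.exp (2 * π * Complex.I * q * ((j:ℂ) + 1)))) := by
  rw [← tendsto_add_atTop_iff_nat 1]
  simp_rw [sum_exp_mul_cpow_eq]
  rw [← zero_sub (∑' i : ℕ, _)]
  refine Tendsto.sub ?_ ?_
  · refine squeeze_zero_norm (fun N => norm_boundary_term_le hq hs N) ?_
    rw [← mul_zero (1 / √(Real.sin (π * q)))]
    refine Tendsto.const_mul _ ?_
    exact (tendsto_rpow_neg_atTop (by norm_num : (0:ℝ) < 1 / 4)).comp
      (tendsto_atTop_add_const_right _ _ tendsto_natCast_atTop_atTop)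
  · refine (Summable.hasSum ?_).tendsto_sum_nat
    exact Summable.of_norm_bounded (summable_add_one_rpow.mul_left _)
      (fun i => norm_term_le hq hs le_rfl i)

theorem norm_sum_exp_mul_cpow_le {q : ℝ} (hq : q ∈ Set.Ioo (0:ℝ) 1) {s : ℂ} (hs : 3 / 4 < s.re)
    {R : ℝ} (hR : ‖s‖ ≤ R) (N : ℕ) :
    ‖∑ j ∈ Finset.range N,
      Complex.exp (2 * π * Complex.I * q * ((j:ℂ) + 1)) * ((j : ℂ) + 1) ^ (-s)‖ ≤
      (1 + R * ∑' i : ℕ, ((i : ℝ) + 1) ^ (-(5 / 4) : ℝ)) / √(Real.sin (π * q)) := by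
  have hR0 : 0 ≤ R := (norm_nonneg s).trans hR
  rcases N with _ | N
  · simp only [Finset.range_zero, Finset.sum_empty, norm_zero]
    have : 0 ≤ ∑' i : ℕ, ((i : ℝ) + 1) ^ (-(5 / 4) : ℝ) := tsum_nonneg fun i => by positivity
    positivity
  rw [sum_exp_mul_cpow_eq]
  refine (norm_sub_le _ _).trans ?_
  rw [add_div]
  gcongr ?_ + ?_
  · refine (norm_boundary_term_le hq hs N).trans ?_
    refine mul_le_of_le_one_right (by positivity) ?_
    exact Real.rpow_le_one_of_one_le_of_nonpos (by simp) (by norm_num)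
  · refine (norm_sum_le _ _).trans ?_
    refine (Finset.sum_le_sum fun i _ => norm_term_le hq hs hR i).trans ?_
    rw [← Finset.mul_sum, mul_div_right_comm]
    gcongr
    exact summable_add_one_rpow.sum_le_tsum _ fun i _ => by positivity

theorem coe_ne_zero_of_mem_Ioo {q : ℝ} (hq : q ∈ Set.Ioo (0:ℝ) 1) : (q : UnitAddCircle) ≠ 0 := by
  intro h
  rw [AddCircle.coe_eq_zero_iff] at h
  obtain ⟨n, hn⟩ := h
  simp only [zsmul_eq_mul, mul_one] at hn
  have h1 : (0 : ℝ) < n := hn ▸ hq.1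
  have h2 : (n : ℝ) < 1 := hn ▸ hq.2
  norm_cast at h1 h2
  omega

theorem tendsto_sum_expZeta {q : ℝ} (hq : q ∈ Set.Ioo (0:ℝ) 1) {s : ℂ} (hs : 3 / 4 < s.re) :
    Tendsto (fun N : ℕ => ∑ j ∈ Finset.range N,
      Complex.exp (2 * π * Complex.I * q * ((j:ℂ) + 1)) * ((j : ℂ) + 1) ^ (-s)) atTop
      (𝓝 (HurwitzZeta.expZeta q s)) := by
  set G : ℂ → ℂ := fun s => -∑' i : ℕ, (((i : ℂ) + 1 + 1) ^ (-s) - ((i : ℂ) + 1) ^ (-s)) *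
      ∑ j ∈ Finset.range (i + 1), Complex.exp (2 * π * Complex.I * q * ((j:ℂ) + 1)) with hG
  suffices h : HurwitzZeta.expZeta q s = G s by
    rw [h]; exact tendsto_sum_exp_tsum hq hs
  have hG1 (w : ℂ) (hw : 1 < w.re) : HurwitzZeta.expZeta q w = G w := by
    refine tendsto_nhds_unique ?_ (tendsto_sum_exp_tsum hq (by linarith))
    have := (HurwitzZeta.hasSum_expZeta_of_one_lt_re q hw).tendsto_sum_nat
    rw [← tendsto_add_atTop_iff_nat 1] at this
    refine this.congr fun N => ?_
    rw [Finset.sum_range_succ']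
    have hw0 : w ≠ 0 := by rintro rfl; simp at hw; linarith
    simp [Complex.zero_cpow hw0, Complex.cpow_neg, div_eq_mul_inv]
  set U : Set ℂ := {w | 3 / 4 < w.re} ∩ Metric.ball 0 (‖s‖ + 3) with hU
  have hUo : IsOpen U := (isOpen_lt continuous_const Complex.continuous_re).inter Metric.isOpen_ball
  have hUc : IsPreconnected U :=
    ((convex_halfSpace_re_gt _).inter (convex_ball _ _)).isPreconnected
  have hsU : s ∈ U := ⟨hs, by simp⟩
  have h2U : (2 : ℂ) ∈ U := ⟨by simp; norm_num, by simp; linarith [norm_nonneg s]⟩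
  have hE : AnalyticOnNhd ℂ (HurwitzZeta.expZeta q) U :=
    ((HurwitzZeta.differentiable_expZeta_of_ne_zero
      (coe_ne_zero_of_mem_Ioo hq)).differentiableOn).analyticOnNhd hUo
  have hGd : DifferentiableOn ℂ G U := by
    refine (Complex.differentiableOn_tsum_of_summable_norm
      (summable_add_one_rpow.mul_left ((‖s‖ + 3) / √(Real.sin (π * q))))
      (fun i => ?_) hUo (fun i w hw => norm_term_le hq hw.1
        (by have := hw.2; simp at this; linarith) i)).neg
    have hd (x : ℂ) (hx : x ≠ 0) : Differentiable ℂ fun w : ℂ => x ^ (-w) := fun w =>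
      (differentiableAt_id.neg).const_cpow (Or.inl hx)
    exact (((hd _ (by norm_cast)).sub (hd _ (by norm_cast))).mul_const _).differentiableOn
  refine hE.eqOn_of_preconnected_of_eventuallyEq (hGd.analyticOnNhd hUo) hUc h2U ?_ hsU
  have : {w : ℂ | 1 < w.re} ∈ 𝓝 (2 : ℂ) :=
    (isOpen_lt continuous_const Complex.continuous_re).mem_nhds (by simp)
  filter_upwards [this] with w hw using hG1 w hw

theorem norm_expZeta_le {q : ℝ} (hq : q ∈ Set.Ioo (0:ℝ) 1) {s : ℂ} (hs : 3 / 4 < s.re)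
    {R : ℝ} (hR : ‖s‖ ≤ R) :
    ‖HurwitzZeta.expZeta q s‖ ≤
      (1 + R * ∑' i : ℕ, ((i : ℝ) + 1) ^ (-(5 / 4) : ℝ)) / √(Real.sin (π * q)) :=
  le_of_tendsto' (tendsto_sum_expZeta hq hs).norm fun N => norm_sum_exp_mul_cpow_le hq hs hR N

theorem coe_one_sub_eq_neg (q : ℝ) : ((1 - q : ℝ) : UnitAddCircle) = -(q : UnitAddCircle) := by
  rw [AddCircle.coe_sub, AddCircle.coe_period, zero_sub]

theorem one_sub_mem_Ioo {q : ℝ} (hq : q ∈ Set.Ioo (0:ℝ) 1) : 1 - q ∈ Set.Ioo (0:ℝ) 1 :=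
  ⟨by linarith [hq.2], by linarith [hq.1]⟩

theorem hurwitzZeta_one_sub_of_re_pos {q : ℝ} (hq : q ∈ Set.Ioo (0:ℝ) 1) {s : ℂ} (hs : 0 < s.re) :
    HurwitzZeta.hurwitzZeta q (1 - s) = (2 * π) ^ (-s) * Complex.Gamma s *
    (Complex.exp (-π * Complex.I * s / 2) * HurwitzZeta.expZeta q s +
      Complex.exp (π * Complex.I * s / 2) * HurwitzZeta.expZeta ((1 - q : ℝ) : UnitAddCircle) s) := by
  rw [coe_one_sub_eq_neg]
  refine HurwitzZeta.hurwitzZeta_one_sub _ (fun n h => ?_) (Or.inl (coe_ne_zero_of_mem_Ioo hq))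
  rw [h] at hs
  simp at hs
  linarith [(Nat.cast_nonneg n : (0:ℝ) ≤ n)]

theorem hurwitzZeta_add_one_sub {q : ℝ} (hq : q ∈ Set.Ioo (0:ℝ) 1) {s : ℂ} (hs : 0 < s.re) :
    HurwitzZeta.hurwitzZeta q (1 - s) + HurwitzZeta.hurwitzZeta ((1 - q : ℝ) : UnitAddCircle) (1 - s) =
    2 * (2 * π) ^ (-s) * Complex.Gamma s * (HurwitzZeta.expZeta q s +
      HurwitzZeta.expZeta ((1 - q : ℝ) : UnitAddCircle) s) * Complex.cos (π * s / 2) := by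
  rw [hurwitzZeta_one_sub_of_re_pos hq hs, hurwitzZeta_one_sub_of_re_pos (one_sub_mem_Ioo hq) hs,
    sub_sub_cancel, Complex.cos,
    show -(π * s / 2) * Complex.I = -π * Complex.I * s / 2 by ring,
    show π * s / 2 * Complex.I = π * Complex.I * s / 2 by ring]
  ring

theorem hurwitzZeta_sub_one_sub {q : ℝ} (hq : q ∈ Set.Ioo (0:ℝ) 1) {s : ℂ} (hs : 0 < s.re) :
    HurwitzZeta.hurwitzZeta q (1 - s) - HurwitzZeta.hurwitzZeta ((1 - q : ℝ) : UnitAddCircle) (1 - s) =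
    -2 * Complex.I * (2 * π) ^ (-s) * Complex.Gamma s * (HurwitzZeta.expZeta q s -
      HurwitzZeta.expZeta ((1 - q : ℝ) : UnitAddCircle) s) * Complex.sin (π * s / 2) := by
  rw [hurwitzZeta_one_sub_of_re_pos hq hs, hurwitzZeta_one_sub_of_re_pos (one_sub_mem_Ioo hq) hs,
    sub_sub_cancel, Complex.sin,
    show -(π * s / 2) * Complex.I = -π * Complex.I * s / 2 by ring,
    show π * s / 2 * Complex.I = π * Complex.I * s / 2 by ring]
  linear_combination ((2 * π) ^ (-s) * Complex.Gamma s * (HurwitzZeta.expZeta q s -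
      HurwitzZeta.expZeta ((1 - q : ℝ) : UnitAddCircle) s) *
      (Complex.exp (-π * Complex.I * s / 2) - Complex.exp (π * Complex.I * s / 2))) * Complex.I_sq

theorem hasDerivAt_hurwitzZeta_one_sub (q : ℝ) {k : ℕ} (hk : k ≠ 0) :
    HasDerivAt (fun s : ℂ => HurwitzZeta.hurwitzZeta q (1 - s))
      (-deriv (fun z : ℂ => HurwitzZeta.hurwitzZeta q z) (1 - (k : ℂ))) (k : ℂ) := by
  have h1 : (1 - (k : ℂ)) ≠ 1 := by simpa using hk
  have h2 := (HurwitzZeta.differentiableAt_hurwitzZeta q h1).hasDerivAt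
  have h3 : HasDerivAt (fun s : ℂ => 1 - s) (-1) (k : ℂ) := by
    simpa using (hasDerivAt_id (k : ℂ)).const_sub 1
  have h4 := h2.comp (k : ℂ) h3
  rw [mul_neg_one] at h4
  exact h4

theorem re_pos_mem_nhds {k : ℕ} (hk : k ≠ 0) : {s : ℂ | 0 < s.re} ∈ 𝓝 (k : ℂ) :=
  (isOpen_lt continuous_const Complex.continuous_re).mem_nhds (by simp; omega)

theorem differentiableAt_two_pi_cpow_neg (s : ℂ) :
    DifferentiableAt ℂ (fun s : ℂ => (2 * π : ℂ) ^ (-s)) s :=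
  differentiableAt_id.neg.const_cpow (Or.inl (by norm_cast; positivity))

theorem differentiableAt_Gamma_natCast {k : ℕ} (hk : k ≠ 0) :
    DifferentiableAt ℂ Complex.Gamma (k : ℂ) := by
  refine Complex.differentiableAt_Gamma _ fun m h => ?_
  have : (k : ℝ) = -m := by exact_mod_cast congrArg Complex.re h
  have h1 : (0 : ℝ) < k := by positivity
  linarith [(Nat.cast_nonneg m : (0:ℝ) ≤ m)]

theorem differentiableAt_expZeta_coe {q : ℝ} (hq : q ∈ Set.Ioo (0:ℝ) 1) (s : ℂ) :
    DifferentiableAt ℂ (HurwitzZeta.expZeta q) s :=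
  HurwitzZeta.differentiable_expZeta_of_ne_zero (coe_ne_zero_of_mem_Ioo hq) s

theorem deriv_hurwitzZeta_add {q : ℝ} (hq : q ∈ Set.Ioo (0:ℝ) 1) {k : ℕ} (hk : Odd k) :
    deriv (fun z : ℂ => HurwitzZeta.hurwitzZeta q z) (1 - (k : ℂ)) +
      deriv (fun z : ℂ => HurwitzZeta.hurwitzZeta ((1 - q : ℝ) : UnitAddCircle) z) (1 - (k : ℂ)) =
    2 * (2 * π) ^ (-(k : ℂ)) * Complex.Gamma k * (HurwitzZeta.expZeta q k +
      HurwitzZeta.expZeta ((1 - q : ℝ) : UnitAddCircle) k) * (Complex.sin (π * k / 2) * (π / 2)) := by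
  have hk0 : k ≠ 0 := by rintro rfl; simp at hk
  have hL := (hasDerivAt_hurwitzZeta_one_sub q hk0).add (hasDerivAt_hurwitzZeta_one_sub (1 - q) hk0)
  have hcos : Complex.cos (π * k / 2) = 0 := by
    obtain ⟨j, rfl⟩ := hk
    rw [Complex.cos_eq_zero_iff]
    exact ⟨j, by push_cast; ring⟩
  have ht : HasDerivAt (fun s : ℂ => Complex.cos (π * s / 2)) (-Complex.sin (π * k / 2) * (π / 2))
      (k : ℂ) := by
    have : HasDerivAt (fun s : ℂ => π * s / 2) (π / 2 : ℂ) (k : ℂ) := by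
      simpa using ((hasDerivAt_id (k : ℂ)).const_mul (π : ℂ)).div_const 2
    exact this.ccos
  have hu : DifferentiableAt ℂ (fun s : ℂ => 2 * (2 * π : ℂ) ^ (-s) * Complex.Gamma s *
      (HurwitzZeta.expZeta q s + HurwitzZeta.expZeta ((1 - q : ℝ) : UnitAddCircle) s)) (k : ℂ) :=
    (((differentiableAt_two_pi_cpow_neg _).const_mul _).mul (differentiableAt_Gamma_natCast hk0)).mul
      ((differentiableAt_expZeta_coe hq _).add
        (differentiableAt_expZeta_coe (one_sub_mem_Ioo hq) _))
  have hR := hu.hasDerivAt.mul ht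
  have := hL.unique (hR.congr_of_eventuallyEq (by
    filter_upwards [re_pos_mem_nhds hk0] with s hs using hurwitzZeta_add_one_sub hq hs))
  rw [hcos] at this
  linear_combination -this

theorem deriv_hurwitzZeta_sub {q : ℝ} (hq : q ∈ Set.Ioo (0:ℝ) 1) {k : ℕ} (hk0 : k ≠ 0)
    (hk : Even k) :
    deriv (fun z : ℂ => HurwitzZeta.hurwitzZeta q z) (1 - (k : ℂ)) -
      deriv (fun z : ℂ => HurwitzZeta.hurwitzZeta ((1 - q : ℝ) : UnitAddCircle) z) (1 - (k : ℂ)) =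
    2 * Complex.I * (2 * π) ^ (-(k : ℂ)) * Complex.Gamma k * (HurwitzZeta.expZeta q k -
      HurwitzZeta.expZeta ((1 - q : ℝ) : UnitAddCircle) k) * (Complex.cos (π * k / 2) * (π / 2)) := by
  have hL := (hasDerivAt_hurwitzZeta_one_sub q hk0).sub (hasDerivAt_hurwitzZeta_one_sub (1 - q) hk0)
  have hsin : Complex.sin (π * k / 2) = 0 := by
    obtain ⟨j, rfl⟩ := hk
    rw [Complex.sin_eq_zero_iff]
    exact ⟨j, by push_cast; ring⟩
  have ht : HasDerivAt (fun s : ℂ => Complex.sin (π * s / 2)) (Complex.cos (π * k / 2) * (π / 2))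
      (k : ℂ) := by
    have : HasDerivAt (fun s : ℂ => π * s / 2) (π / 2 : ℂ) (k : ℂ) := by
      simpa using ((hasDerivAt_id (k : ℂ)).const_mul (π : ℂ)).div_const 2
    exact this.csin
  have hu : DifferentiableAt ℂ (fun s : ℂ => -2 * Complex.I * (2 * π : ℂ) ^ (-s) * Complex.Gamma s *
      (HurwitzZeta.expZeta q s - HurwitzZeta.expZeta ((1 - q : ℝ) : UnitAddCircle) s)) (k : ℂ) :=
    (((differentiableAt_two_pi_cpow_neg _).const_mul _).mul (differentiableAt_Gamma_natCast hk0)).mul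
      ((differentiableAt_expZeta_coe hq _).sub
        (differentiableAt_expZeta_coe (one_sub_mem_Ioo hq) _))
  have hR := hu.hasDerivAt.mul ht
  have := hL.unique (hR.congr_of_eventuallyEq (by
    filter_upwards [re_pos_mem_nhds hk0] with s hs using hurwitzZeta_sub_one_sub hq hs))
  rw [hsin] at this
  linear_combination -this

theorem two_pi_cpow_mul_Gamma {k : ℕ} (hk : k ≠ 0) :
    (k : ℂ) * ((2 * π : ℂ) ^ (-(k : ℂ)) * Complex.Gamma k) =
      ((k.factorial / (2 * π) ^ k : ℝ) : ℂ) := by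
  obtain ⟨j, rfl⟩ := Nat.exists_eq_succ_of_ne_zero hk
  rw [Nat.succ_eq_add_one, Nat.cast_add_one, Complex.Gamma_nat_eq_factorial, Nat.factorial_succ,
    Complex.cpow_neg, ← Nat.cast_add_one, Complex.cpow_natCast]
  push_cast
  ring

theorem natCast_add_one_cpow_neg (j k : ℕ) :
    ((j : ℂ) + 1) ^ (-(k : ℂ)) = ((1 / ((j : ℝ) + 1) ^ k : ℝ) : ℂ) := by
  rw [Complex.cpow_neg, Complex.cpow_natCast]; push_cast; rw [one_div]

theorem exp_eq_cos_add_sin (q : ℝ) (j : ℕ) :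
    Complex.exp (2 * π * Complex.I * q * ((j:ℂ) + 1)) =
      (Real.cos (2 * π * ((j:ℝ) + 1) * q) : ℂ) +
        (Real.sin (2 * π * ((j:ℝ) + 1) * q) : ℂ) * Complex.I := by
  push_cast
  rw [← Complex.exp_mul_I]; congr 1; ring

theorem exp_one_sub_eq (q : ℝ) (j : ℕ) :
    Complex.exp (2 * π * Complex.I * (1 - q : ℝ) * ((j:ℂ) + 1)) =
      (Real.cos (2 * π * ((j:ℝ) + 1) * q) : ℂ) -
        (Real.sin (2 * π * ((j:ℝ) + 1) * q) : ℂ) * Complex.I := by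
  have := Complex.exp_periodic.nat_mul (j + 1) (2 * π * Complex.I * (-q) * ((j:ℂ) + 1))
  rw [show (2 * π * Complex.I * (1 - q : ℝ) * ((j:ℂ) + 1)) =
    2 * π * Complex.I * (-q) * ((j:ℂ) + 1) + (j + 1 : ℕ) * (2 * π * Complex.I) by push_cast; ring, this]
  push_cast
  rw [sub_eq_add_neg, ← neg_mul, ← Complex.cos_neg, ← Complex.sin_neg, ← Complex.exp_mul_I]
  congr 1; ring

/-- Up to a constant, the even part of `A k` is `∑ cos (2 π j q) / j ^ k` for odd `k`. -/
theorem tendsto_A_add {q : ℝ} (hq : q ∈ Set.Ioo (0:ℝ) 1) {k : ℕ} (hk : Odd k) :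
    Tendsto (fun N : ℕ => 2 * π * (k.factorial / (2 * π) ^ k) * Real.sin (π * k / 2) *
      ∑ j ∈ Finset.range N, Real.cos (2 * π * ((j:ℝ) + 1) * q) * (1 / ((j : ℝ) + 1) ^ k)) atTop
      (𝓝 (A k q + A k (1 - q))) := by
  have hk0 : k ≠ 0 := by rintro rfl; simp at hk
  have hre : 3 / 4 < (k : ℂ).re := by
    have : (1 : ℝ) ≤ k := by exact_mod_cast Nat.one_le_iff_ne_zero.mpr hk0
    simp; linarith
  have h1 := (tendsto_sum_expZeta hq hre).add (tendsto_sum_expZeta (one_sub_mem_Ioo hq) hre)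
  have h2 := h1.const_mul (((k.factorial / (2 * π) ^ k : ℝ) : ℂ) * Real.sin (π * k / 2) * π)
  have h3 := (Complex.continuous_re.tendsto _).comp h2
  have e : A k q + A k (1 - q) = (((k.factorial / (2 * π) ^ k : ℝ) : ℂ) * Real.sin (π * k / 2) * π *
      (HurwitzZeta.expZeta q k + HurwitzZeta.expZeta ((1 - q : ℝ) : UnitAddCircle) k)).re := by
    rw [A, A, ← mul_add, ← Complex.add_re, deriv_hurwitzZeta_add hq hk, ← Complex.re_ofReal_mul,
      ← two_pi_cpow_mul_Gamma hk0]
    congr 1; push_cast; ring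
  rw [e]
  refine h3.congr fun N => ?_
  simp only [Function.comp]
  rw [← Finset.sum_add_distrib, ← Complex.ofReal_re (_ * ∑ j ∈ Finset.range N, _)]
  congr 1
  push_cast [Finset.mul_sum]
  refine Finset.sum_congr rfl fun j _ => ?_
  have h4 := exp_eq_cos_add_sin q j
  have h5 := exp_one_sub_eq q j
  push_cast at h4 h5
  rw [natCast_add_one_cpow_neg, h4, h5]
  push_cast
  ring

/-- Up to a constant, the odd part of `A k` is `∑ sin (2 π j q) / j ^ k` for even `k`. -/
theorem tendsto_A_sub {q : ℝ} (hq : q ∈ Set.Ioo (0:ℝ) 1) {k : ℕ} (hk0 : k ≠ 0) (hk : Even k) :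
    Tendsto (fun N : ℕ => -(2 * π * (k.factorial / (2 * π) ^ k) * Real.cos (π * k / 2)) *
      ∑ j ∈ Finset.range N, Real.sin (2 * π * ((j:ℝ) + 1) * q) * (1 / ((j : ℝ) + 1) ^ k)) atTop
      (𝓝 (A k q - A k (1 - q))) := by
  have hre : 3 / 4 < (k : ℂ).re := by
    have : (1 : ℝ) ≤ k := by exact_mod_cast Nat.one_le_iff_ne_zero.mpr hk0
    simp; linarith
  have h1 := (tendsto_sum_expZeta hq hre).sub (tendsto_sum_expZeta (one_sub_mem_Ioo hq) hre)
  have h2 := h1.const_mul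
    (((k.factorial / (2 * π) ^ k : ℝ) : ℂ) * Real.cos (π * k / 2) * π * Complex.I)
  have h3 := (Complex.continuous_re.tendsto _).comp h2
  have e : A k q - A k (1 - q) =
      (((k.factorial / (2 * π) ^ k : ℝ) : ℂ) * Real.cos (π * k / 2) * π * Complex.I *
      (HurwitzZeta.expZeta q k - HurwitzZeta.expZeta ((1 - q : ℝ) : UnitAddCircle) k)).re := by
    rw [A, A, ← mul_sub, ← Complex.sub_re, deriv_hurwitzZeta_sub hq hk0 hk, ← Complex.re_ofReal_mul,
      ← two_pi_cpow_mul_Gamma hk0]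
    congr 1; push_cast; ring
  rw [e]
  refine h3.congr fun N => ?_
  simp only [Function.comp]
  rw [← Finset.sum_sub_distrib, ← Complex.ofReal_re (_ * ∑ j ∈ Finset.range N, _)]
  congr 1
  push_cast [Finset.mul_sum]
  refine Finset.sum_congr rfl fun j _ => ?_
  have h4 := exp_eq_cos_add_sin q j
  have h5 := exp_one_sub_eq q j
  push_cast at h4 h5
  rw [natCast_add_one_cpow_neg, h4, h5]
  push_cast
  linear_combination (2 * (k.factorial / (2 * π) ^ k : ℂ) * Complex.cos (π * k / 2) * π *
    Complex.sin (2 * π * ((j:ℂ) + 1) * q) * (1 / ((j : ℂ) + 1) ^ k)) * Complex.I_sq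

theorem sin_pi_mul_pos {q : ℝ} (hq : q ∈ Set.Ioo (0:ℝ) 1) : 0 < Real.sin (π * q) :=
  Real.sin_pos_of_pos_of_lt_pi (by nlinarith [hq.1, pi_pos]) (by nlinarith [hq.2, pi_pos])

theorem exists_abs_A_le {k : ℕ} (hk : k ≠ 0) :
    ∃ M : ℝ, ∀ q ∈ Set.Ioo (0:ℝ) 1, |A k q| ≤ M / √(Real.sin (π * q)) := by
  have hk1 : (1 : ℝ) ≤ k := by exact_mod_cast Nat.one_le_iff_ne_zero.mpr hk
  have hre {s : ℂ} (hs : ‖s - k‖ = 1 / 8) : 3 / 4 < s.re := by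
    have := (Complex.abs_re_le_norm (s - k)).trans hs.le
    rw [abs_le] at this
    simp at this
    linarith
  set g : ℂ → ℝ := fun s => ‖(2 * π : ℂ) ^ (-s) * Complex.Gamma s‖ *
    (‖Complex.exp (-π * Complex.I * s / 2)‖ + ‖Complex.exp (π * Complex.I * s / 2)‖) with hg
  have hgc : ContinuousOn g (Metric.sphere (k : ℂ) (1 / 8)) := by
    intro s hs
    have hs' := hre (by simpa [dist_eq_norm] using hs)
    have hG : DifferentiableAt ℂ Complex.Gamma s := by
      refine Complex.differentiableAt_Gamma _ fun m h => ?_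
      rw [h] at hs'
      simp at hs'
      linarith [(Nat.cast_nonneg m : (0:ℝ) ≤ m)]
    refine ContinuousAt.continuousWithinAt ?_
    refine ((differentiableAt_two_pi_cpow_neg s).continuousAt.mul hG.continuousAt).norm.mul ?_
    fun_prop
  obtain ⟨M, hM⟩ := (isCompact_sphere (k : ℂ) (1 / 8)).exists_bound_of_continuousOn hgc
  set Z := 1 + ((k : ℝ) + 1) * ∑' i : ℕ, ((i : ℝ) + 1) ^ (-(5 / 4) : ℝ) with hZ
  have hZ0 : 0 ≤ Z := by
    have : 0 ≤ ∑' i : ℕ, ((i : ℝ) + 1) ^ (-(5 / 4) : ℝ) := tsum_nonneg fun i => by positivity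
    positivity
  refine ⟨k * (M * Z / (1 / 8)), fun q hq => ?_⟩
  have hsin := sin_pi_mul_pos hq
  have hsph : ∀ z ∈ Metric.sphere (1 - (k : ℂ)) (1 / 8),
      ‖HurwitzZeta.hurwitzZeta q z‖ ≤ M * Z / √(Real.sin (π * q)) := by
    intro z hz
    have hs : ‖(1 - z) - k‖ = 1 / 8 := by
      rw [← (mem_sphere_iff_norm.mp hz), ← norm_neg]; congr 1; ring
    have hs' := hre hs
    have hn : ‖1 - z‖ ≤ k + 1 := by
      have := norm_add_le ((1 - z) - k) (k : ℂ)
      rw [sub_add_cancel, hs, Complex.norm_natCast] at this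
      linarith
    have h1 := norm_expZeta_le hq hs' hn
    have h2 := norm_expZeta_le (one_sub_mem_Ioo hq) hs' hn
    rw [show π * (1 - q) = π - π * q by ring, Real.sin_pi_sub] at h2
    have h3 := hM (1 - z) (mem_sphere_iff_norm.mpr hs)
    rw [Real.norm_of_nonneg (by positivity)] at h3
    have h4 := hurwitzZeta_one_sub_of_re_pos hq (s := 1 - z) (by linarith)
    rw [sub_sub_cancel] at h4
    rw [h4, norm_mul]
    calc _ ≤ ‖(2 * π : ℂ) ^ (-(1 - z)) * Complex.Gamma (1 - z)‖ *
        (‖Complex.exp (-π * Complex.I * (1 - z) / 2)‖ * (Z / √(Real.sin (π * q))) +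
          ‖Complex.exp (π * Complex.I * (1 - z) / 2)‖ * (Z / √(Real.sin (π * q)))) := by
          gcongr
          refine (norm_add_le _ _).trans ?_
          rw [norm_mul, norm_mul]
          gcongr
      _ = g (1 - z) * (Z / √(Real.sin (π * q))) := by rw [hg]; ring
      _ ≤ M * (Z / √(Real.sin (π * q))) := by gcongr
      _ = _ := by ring
  have hd : DiffContOnCl ℂ (HurwitzZeta.hurwitzZeta q) (Metric.ball (1 - (k : ℂ)) (1 / 8)) := by
    refine DifferentiableOn.diffContOnCl_ball (U := {1}ᶜ)
      (fun z hz => (HurwitzZeta.differentiableAt_hurwitzZeta q hz).differentiableWithinAt) ?_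
    intro z hz h
    rw [Set.mem_singleton_iff] at h
    rw [h, Metric.mem_closedBall, dist_eq_norm, sub_sub_cancel, Complex.norm_natCast] at hz
    linarith
  have h5 := Complex.norm_deriv_le_of_forall_mem_sphere_norm_le (by norm_num) hd hsph
  rw [A, abs_mul, Nat.abs_cast]
  calc _ ≤ (k : ℝ) * (M * Z / √(Real.sin (π * q)) / (1 / 8)) := by
        gcongr
        exact (Complex.abs_re_le_norm _).trans h5
    _ = _ := by ring

theorem aestronglyMeasurable_expZeta {s : ℂ} (hs : 3 / 4 < s.re) :
    AEStronglyMeasurable (fun q : ℝ => HurwitzZeta.expZeta q s)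
      (volume.restrict (Set.Ioo (0:ℝ) 1)) := by
  refine aestronglyMeasurable_of_tendsto_ae atTop (fun N => ?_)
    ((ae_restrict_mem measurableSet_Ioo).mono fun q hq => tendsto_sum_expZeta hq hs)
  exact Continuous.aestronglyMeasurable (by fun_prop)

theorem aestronglyMeasurable_expZeta_one_sub {s : ℂ} (hs : 3 / 4 < s.re) :
    AEStronglyMeasurable (fun q : ℝ => HurwitzZeta.expZeta ((1 - q : ℝ) : UnitAddCircle) s)
      (volume.restrict (Set.Ioo (0:ℝ) 1)) := by
  refine aestronglyMeasurable_of_tendsto_ae atTop (fun N => ?_)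
    ((ae_restrict_mem measurableSet_Ioo).mono fun q hq =>
      tendsto_sum_expZeta (one_sub_mem_Ioo hq) hs)
  exact Continuous.aestronglyMeasurable (by fun_prop)

theorem aestronglyMeasurable_hurwitzZeta {s : ℂ} (hs : 3 / 4 < s.re) :
    AEStronglyMeasurable (fun q : ℝ => HurwitzZeta.hurwitzZeta q (1 - s))
      (volume.restrict (Set.Ioo (0:ℝ) 1)) := by
  have h := (((aestronglyMeasurable_expZeta hs).const_mul
    (Complex.exp (-π * Complex.I * s / 2))).add ((aestronglyMeasurable_expZeta_one_sub hs).const_mul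
    (Complex.exp (π * Complex.I * s / 2)))).const_mul ((2 * π : ℂ) ^ (-s) * Complex.Gamma s)
  refine h.congr ((ae_restrict_mem measurableSet_Ioo).mono fun q hq => ?_)
  exact (hurwitzZeta_one_sub_of_re_pos hq (by linarith)).symm

theorem aestronglyMeasurable_A {k : ℕ} (hk : k ≠ 0) :
    AEStronglyMeasurable (A k) (volume.restrict (Set.Ioo (0:ℝ) 1)) := by
  have hk1 : (1 : ℝ) ≤ k := by exact_mod_cast Nat.one_le_iff_ne_zero.mpr hk
  set d : ℕ → ℂ := fun n => 1 - ((k : ℂ) + 1 / ((n : ℂ) + 1)) with hd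
  have hd1 : Tendsto d atTop (𝓝[≠] (1 - (k : ℂ))) := by
    refine tendsto_nhdsWithin_iff.mpr ⟨?_, Eventually.of_forall fun n => ?_⟩
    · have := (tendsto_one_div_add_atTop_nhds_zero_nat (𝕜 := ℂ)).const_add (k : ℂ)
      simpa [hd] using this.const_sub 1
    · have : (n : ℂ) + 1 ≠ 0 := by norm_cast
      simp [hd, this]
  have hmeas : AEStronglyMeasurable
      (fun q : ℝ => deriv (fun z : ℂ => HurwitzZeta.hurwitzZeta q z) (1 - (k : ℂ)))
      (volume.restrict (Set.Ioo (0:ℝ) 1)) := by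
    refine aestronglyMeasurable_of_tendsto_ae atTop
      (f := fun n q => slope (fun z : ℂ => HurwitzZeta.hurwitzZeta (q : ℝ) z) (1 - (k : ℂ)) (d n))
      (fun n => ?_) (Eventually.of_forall fun q => ?_)
    · simp only [slope_def_module]
      refine ((aestronglyMeasurable_hurwitzZeta ?_).sub
        (aestronglyMeasurable_hurwitzZeta ?_)).const_smul (d n - (1 - (k : ℂ)))⁻¹
      · have : (1 / ((n : ℂ) + 1)) = ((1 / ((n : ℝ) + 1) : ℝ) : ℂ) := by push_cast; rfl
        have h2 : (0 : ℝ) < 1 / ((n : ℝ) + 1) := by positivity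
        rw [this, Complex.add_re, Complex.ofReal_re, Complex.natCast_re]
        linarith
      · rw [Complex.natCast_re]; linarith
    · have h1 : (1 - (k : ℂ)) ≠ 1 := by simpa using hk
      exact (hasDerivAt_iff_tendsto_slope.mp
        (HurwitzZeta.differentiableAt_hurwitzZeta q h1).hasDerivAt).comp hd1
  exact (Complex.continuous_re.comp_aestronglyMeasurable hmeas).const_mul (k : ℝ)

theorem measurable_K : Measurable K := by
  unfold K
  fun_prop

theorem abs_K_le {q : ℝ} (hq : q ∈ Set.Ioo (0:ℝ) 1) :
    |K q| ≤ 4 * Real.sin (π * q) ^ (-(1 / 4) : ℝ) := by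
  have hs := sin_pi_mul_pos hq
  have := Real.abs_log_mul_self_rpow_lt (Real.sin (π * q)) (1 / 4) hs (Real.sin_le_one _)
    (by norm_num)
  rw [abs_mul, abs_of_pos (Real.rpow_pos_of_pos hs _), ← lt_div_iff₀ (by positivity)] at this
  refine this.le.trans (le_of_eq ?_)
  rw [Real.rpow_neg hs.le]
  norm_num [div_eq_mul_inv]

theorem sin_pi_mul_rpow_le {q : ℝ} (hq : q ∈ Set.Ioo (0:ℝ) 1) :
    Real.sin (π * q) ^ (-(3 / 4) : ℝ) ≤ q ^ (-(3 / 4) : ℝ) + (1 - q) ^ (-(3 / 4) : ℝ) := by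
  have h (x : ℝ) (h0 : 0 < x) (h1 : x ≤ 1 / 2) : x ≤ Real.sin (π * x) := by
    have := Real.mul_le_sin (x := π * x) (by positivity) (by nlinarith [pi_pos])
    have e : 2 / π * (π * x) = 2 * x := by field_simp
    linarith
  have h1 : 0 < 1 - q := by linarith [hq.2]
  have h0 := hq.1
  rcases le_total q (1 / 2) with hle | hle
  · have := Real.rpow_le_rpow_of_nonpos h0 (h q h0 hle) (show (-(3 / 4) : ℝ) ≤ 0 by norm_num)
    have : 0 ≤ (1 - q) ^ (-(3 / 4) : ℝ) := by positivity
    linarith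
  · have h2 := h (1 - q) h1 (by linarith)
    rw [show π * (1 - q) = π - π * q by ring, Real.sin_pi_sub] at h2
    have := Real.rpow_le_rpow_of_nonpos h1 h2 (show (-(3 / 4) : ℝ) ≤ 0 by norm_num)
    have : 0 ≤ q ^ (-(3 / 4) : ℝ) := by positivity
    linarith

theorem integrableOn_K_div_sqrt :
    IntegrableOn (fun q => 1 / √(Real.sin (π * q)) * |K q|) (Set.Ioo (0:ℝ) 1) := by
  have h1 : IntervalIntegrable (fun q : ℝ => q ^ (-(3 / 4) : ℝ)) volume 0 1 :=
    intervalIntegral.intervalIntegrable_rpow' (by norm_num)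
  have h2 : IntervalIntegrable (fun q : ℝ => (1 - q) ^ (-(3 / 4) : ℝ)) volume 0 1 := by
    simpa using (h1.comp_sub_left 1).symm
  have h3 := ((h1.add h2).const_mul 4)
  rw [intervalIntegrable_iff_integrableOn_Ioo_of_le zero_le_one] at h3
  refine Integrable.mono' h3 ?_ ((ae_restrict_mem measurableSet_Ioo).mono fun q hq => ?_)
  · exact (Measurable.mul (by fun_prop) measurable_K.abs).aestronglyMeasurable
  · have hs := sin_pi_mul_pos hq
    rw [Real.norm_of_nonneg (by positivity)]
    calc _ ≤ 1 / √(Real.sin (π * q)) * (4 * Real.sin (π * q) ^ (-(1 / 4) : ℝ)) := by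
          gcongr; exact abs_K_le hq
      _ = 4 * (Real.sin (π * q) ^ (-(1 / 2) : ℝ) * Real.sin (π * q) ^ (-(1 / 4) : ℝ)) := by
          rw [Real.sqrt_eq_rpow, Real.rpow_neg hs.le (1 / 2)]; ring
      _ = 4 * Real.sin (π * q) ^ (-(3 / 4) : ℝ) := by
          rw [← Real.rpow_add hs]; norm_num
      _ ≤ _ := by
          have := sin_pi_mul_rpow_le hq
          linarith

theorem continuous_B (l : ℕ) : Continuous (B l) := by
  unfold B
  exact (Polynomial.bernoulli l).continuous_aeval

theorem integrableOn_A_mul_B_mul_K {k : ℕ} (hk : k ≠ 0) (l : ℕ) :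
    IntegrableOn (fun q => A k q * B l q * K q) (Set.Ioo (0:ℝ) 1) := by
  obtain ⟨M, hM⟩ := exists_abs_A_le hk
  obtain ⟨b, hb⟩ := (isCompact_Icc (a := (0:ℝ)) (b := 1)).exists_bound_of_continuousOn
    (continuous_B l).continuousOn
  refine Integrable.mono' (integrableOn_K_div_sqrt.const_mul (M * b)) ?_
    ((ae_restrict_mem measurableSet_Ioo).mono fun q hq => ?_)
  · exact ((aestronglyMeasurable_A hk).mul (continuous_B l).aestronglyMeasurable).mul
      measurable_K.aestronglyMeasurable
  · rw [norm_mul, norm_mul]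
    have h1 := hM q hq
    have h2 := hb q (Set.Ioo_subset_Icc_self hq)
    calc _ ≤ M / √(Real.sin (π * q)) * b * |K q| := by
          exact mul_le_mul_of_nonneg_right (mul_le_mul h1 h2 (norm_nonneg _)
            ((abs_nonneg _).trans h1)) (abs_nonneg _)
      _ = _ := by ring

theorem B_eq_bernoulliFun (k : ℕ) : B k = bernoulliFun k := by
  funext q
  rw [B, bernoulliFun, Polynomial.eval_map_algebraMap]

theorem B_one_sub (k : ℕ) (q : ℝ) : B k (1 - q) = (-1) ^ k * B k q := by
  rw [B_eq_bernoulliFun, bernoulliFun_eval_one_sub]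

theorem K_one_sub (q : ℝ) : K (1 - q) = K q := by
  rw [K, K, show π * (1 - q) = π - π * q by ring, Real.sin_pi_sub]

theorem intervalIntegrable_K : IntervalIntegrable K volume 0 1 := by
  rw [intervalIntegrable_iff_integrableOn_Ioo_of_le zero_le_one]
  refine Integrable.mono' integrableOn_K_div_sqrt measurable_K.aestronglyMeasurable
    ((ae_restrict_mem measurableSet_Ioo).mono fun q hq => ?_)
  refine le_mul_of_one_le_left (abs_nonneg _) ?_
  rw [le_div_iff₀ (Real.sqrt_pos.mpr (sin_pi_mul_pos hq)), one_mul]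
  exact Real.sqrt_le_one.mpr (Real.sin_le_one _)

theorem integral_cos_mul_B {n : ℕ} (hn0 : n ≠ 0) (hne : Even n) (j : ℕ) :
    ∫ q in (0:ℝ)..1, Real.cos (2 * π * j * q) * B n q =
      -((-1) ^ (n / 2) * (n.factorial / (2 * π) ^ n)) * (1 / (j : ℝ) ^ n) := by
  have h := bernoulliFourierCoeff_eq hn0 j
  rw [bernoulliFourierCoeff, fourierCoeffOn_eq_integral] at h
  have e1 (x : ℝ) : (fourier (-(j : ℤ)) (x : AddCircle (1 - 0 : ℝ)) : ℂ) •
      ((bernoulliFun n x : ℝ) : ℂ) = Complex.exp (((-(2 * π * j * x) : ℝ) : ℂ) * Complex.I) *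
        ((B n x : ℝ) : ℂ) := by
    rw [fourier_coe_apply, smul_eq_mul, B_eq_bernoulliFun]
    congr 2
    push_cast
    ring
  simp_rw [e1] at h
  rw [sub_zero, div_one, one_smul] at h
  have h2 := congrArg Complex.re h
  have hB := continuous_B n
  have hint : IntervalIntegrable (fun x : ℝ =>
      Complex.exp (((-(2 * π * j * x) : ℝ) : ℂ) * Complex.I) * ((B n x : ℝ) : ℂ)) volume 0 1 :=
    Continuous.intervalIntegrable (by fun_prop) _ _
  have h3 := Complex.reCLM.intervalIntegral_comp_comm hint
  simp only [Complex.reCLM_apply] at h3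
  rw [← h3] at h2
  simp_rw [Complex.re_mul_ofReal, Complex.exp_ofReal_mul_I_re, Real.cos_neg] at h2
  rw [h2]
  obtain ⟨r, rfl⟩ := hne
  have e2 : (-((r + r).factorial : ℂ) / (2 * π * Complex.I * ((j : ℤ) : ℂ)) ^ (r + r)) =
      ((-((-1) ^ ((r + r) / 2) * ((r + r).factorial / (2 * π) ^ (r + r))) *
        (1 / (j : ℝ) ^ (r + r)) : ℝ) : ℂ) := by
    have : Complex.I ^ (r + r) = (-1) ^ r := by rw [← two_mul, pow_mul, Complex.I_sq]
    rw [mul_pow, mul_pow _ Complex.I, this, show (r + r) / 2 = r by omega]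
    push_cast
    have h1 : ((-1 : ℂ) ^ r)⁻¹ = (-1) ^ r := by rw [← inv_pow]; norm_num
    simp only [div_eq_mul_inv, mul_inv, h1]
    ring
  rw [e2, Complex.ofReal_re]

theorem sin_two_pi_mul_eq (k : ℕ) (q : ℝ) :
    Real.sin (2 * π * k * q) =
      Real.sin (π * q) * ∑ j ∈ Finset.range k, 2 * Real.cos ((2 * j + 1) * (π * q)) := by
  induction k with
  | zero => simp
  | succ k ih =>
    rw [Finset.sum_range_succ, mul_add, ← ih]
    have h1 : 2 * π * (k + 1 : ℕ) * q = (2 * k + 1) * (π * q) + π * q := by push_cast; ring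
    have h2 : 2 * π * k * q = (2 * k + 1) * (π * q) - π * q := by ring
    rw [h1, h2, Real.sin_add, Real.sin_sub]
    ring

theorem sum_cos_mul_cos_eq (k : ℕ) (q : ℝ) :
    (∑ j ∈ Finset.range k, 2 * Real.cos ((2 * j + 1) * (π * q))) * Real.cos (π * q) =
      ∑ j ∈ Finset.range k, (Real.cos (2 * π * (j + 1 : ℕ) * q) + Real.cos (2 * π * j * q)) := by
  rw [Finset.sum_mul]
  refine Finset.sum_congr rfl fun j _ => ?_
  have h1 : 2 * π * (j + 1 : ℕ) * q = (2 * j + 1) * (π * q) + π * q := by push_cast; ring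
  have h2 : 2 * π * j * q = (2 * j + 1) * (π * q) - π * q := by ring
  rw [h1, h2, Real.cos_add, Real.cos_sub]
  ring

/-- Integration by parts against the kernel `K`. -/
theorem integral_deriv_sin_mul_B_mul_K {n : ℕ} (hn0 : n ≠ 0) (hne : Even n) (k : ℕ) :
    ∫ q in (0:ℝ)..1, (2 * π * k * Real.cos (2 * π * k * q) * B n q +
      Real.sin (2 * π * k * q) * (n * B (n - 1) q)) * K q =
      π * ((-1) ^ (n / 2) * (n.factorial / (2 * π) ^ n)) *
        ∑ j ∈ Finset.range k, (1 / ((j : ℝ) + 1) ^ n + 1 / (j : ℝ) ^ n) := by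
  set W : ℝ → ℝ := fun q => ∑ j ∈ Finset.range k,
    (Real.cos (2 * π * (j + 1 : ℕ) * q) * B n q + Real.cos (2 * π * j * q) * B n q) with hW
  have hB := continuous_B n
  have hB' := continuous_B (n - 1)
  have hi1 : IntervalIntegrable (fun q => (2 * π * k * Real.cos (2 * π * k * q) * B n q +
      Real.sin (2 * π * k * q) * (n * B (n - 1) q)) * K q) volume 0 1 :=
    intervalIntegrable_K.continuousOn_mul (Continuous.continuousOn (by fun_prop))
  have hi2 : IntervalIntegrable (fun q => π * W q) volume 0 1 :=
    Continuous.intervalIntegrable (by fun_prop) _ _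
  have hΦ : Continuous fun q => Real.sin (2 * π * k * q) * B n q * K q := by
    have : (fun q => Real.sin (2 * π * k * q) * B n q * K q) = fun q =>
        (∑ j ∈ Finset.range k, 2 * Real.cos ((2 * j + 1) * (π * q))) * B n q *
          (Real.sin (π * q) * Real.log (Real.sin (π * q))) := by
      funext q
      rw [sin_two_pi_mul_eq, K]
      ring
    rw [this]
    have h2 : Continuous fun q : ℝ => Real.sin (π * q) * Real.log (Real.sin (π * q)) :=
      Real.continuous_mul_log.comp (f := fun q : ℝ => Real.sin (π * q)) (by fun_prop)
    fun_prop
  have hparts := intervalIntegral.integral_eq_sub_of_hasDerivAt_of_le zero_le_one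
    hΦ.continuousOn (f' := fun q => (2 * π * k * Real.cos (2 * π * k * q) * B n q +
      Real.sin (2 * π * k * q) * (n * B (n - 1) q)) * K q + π * W q)
    (fun q hq => by
      have hs := sin_pi_mul_pos hq
      have d1 : HasDerivAt (fun q : ℝ => Real.sin (2 * π * k * q))
          (Real.cos (2 * π * k * q) * (2 * π * k)) q := by
        have : HasDerivAt (fun q : ℝ => 2 * π * k * q) (2 * π * k) q := by
          simpa using (hasDerivAt_id q).const_mul (2 * π * k)
        exact this.sin
      have d2 : HasDerivAt (B n) (n * B (n - 1) q) q := by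
        rw [B_eq_bernoulliFun, B_eq_bernoulliFun]
        exact hasDerivAt_bernoulliFun n q
      have d3 : HasDerivAt K (Real.cos (π * q) * π / Real.sin (π * q)) q := by
        have : HasDerivAt (fun q : ℝ => π * q) π q := by
          simpa using (hasDerivAt_id q).const_mul π
        exact this.sin.log hs.ne'
      refine ((d1.mul d2).mul d3).congr_deriv ?_
      have e : Real.sin (2 * π * k * q) * B n q * (Real.cos (π * q) * π / Real.sin (π * q)) =
          π * W q := by
        have hWq : W q = (∑ j ∈ Finset.range k, 2 * Real.cos ((2 * j + 1) * (π * q))) *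
            Real.cos (π * q) * B n q := by
          rw [sum_cos_mul_cos_eq, Finset.sum_mul, hW]
          exact Finset.sum_congr rfl fun _ _ => (add_mul _ _ _).symm
        rw [hWq, sin_two_pi_mul_eq]
        field_simp
      simp only [Pi.mul_apply]
      rw [e]
      ring) (hi1.add hi2)
  rw [intervalIntegral.integral_add hi1 hi2, intervalIntegral.integral_const_mul] at hparts
  have hWint : ∫ q in (0:ℝ)..1, W q =
      -((-1) ^ (n / 2) * (n.factorial / (2 * π) ^ n)) *
        ∑ j ∈ Finset.range k, (1 / ((j : ℝ) + 1) ^ n + 1 / (j : ℝ) ^ n) := by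
    rw [hW, intervalIntegral.integral_finsetSum fun j _ =>
      Continuous.intervalIntegrable (by fun_prop) _ _, Finset.mul_sum]
    refine Finset.sum_congr rfl fun j _ => ?_
    rw [intervalIntegral.integral_add (Continuous.intervalIntegrable (by fun_prop) _ _)
      (Continuous.intervalIntegrable (by fun_prop) _ _), integral_cos_mul_B hn0 hne,
      integral_cos_mul_B hn0 hne]
    push_cast
    ring
  rw [hWint] at hparts
  have hK0 : K 0 = 0 := by simp [K]
  have hK1 : K 1 = 0 := by simp [K]
  rw [hK0, hK1] at hparts
  linear_combination hparts

theorem abs_sum_cos_sin_le {q : ℝ} (hq : q ∈ Set.Ioo (0:ℝ) 1) {k : ℕ} (hk : k ≠ 0) (N : ℕ) :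
    |∑ j ∈ Finset.range N, Real.cos (2 * π * ((j:ℝ) + 1) * q) * (1 / ((j : ℝ) + 1) ^ k)| ≤
      (1 + k * ∑' i : ℕ, ((i : ℝ) + 1) ^ (-(5 / 4) : ℝ)) / √(Real.sin (π * q)) ∧
    |∑ j ∈ Finset.range N, Real.sin (2 * π * ((j:ℝ) + 1) * q) * (1 / ((j : ℝ) + 1) ^ k)| ≤
      (1 + k * ∑' i : ℕ, ((i : ℝ) + 1) ^ (-(5 / 4) : ℝ)) / √(Real.sin (π * q)) := by
  have hre : 3 / 4 < (k : ℂ).re := by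
    have : (1 : ℝ) ≤ k := by exact_mod_cast Nat.one_le_iff_ne_zero.mpr hk
    simp; linarith
  have h := norm_sum_exp_mul_cpow_le hq hre (Complex.norm_natCast k).le N
  simp_rw [natCast_add_one_cpow_neg, exp_eq_cos_add_sin] at h
  constructor
  · refine le_trans (le_of_eq ?_) ((Complex.abs_re_le_norm _).trans h)
    rw [Complex.re_sum]
    congr 1
    refine Finset.sum_congr rfl fun j _ => ?_
    rw [Complex.re_mul_ofReal]
    simp only [Complex.add_re, Complex.ofReal_re, Complex.mul_re, Complex.I_re, Complex.I_im,
      Complex.ofReal_im, mul_zero, mul_one, sub_zero, add_zero]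
  · refine le_trans (le_of_eq ?_) ((Complex.abs_im_le_norm _).trans h)
    rw [Complex.im_sum]
    congr 1
    refine Finset.sum_congr rfl fun j _ => ?_
    rw [Complex.im_mul_ofReal]
    simp only [Complex.add_im, Complex.ofReal_re, Complex.mul_im, Complex.I_re, Complex.I_im,
      Complex.ofReal_im, mul_zero, mul_one, zero_add, add_zero]

theorem integral_symm {f : ℝ → ℝ} (hf : IntegrableOn f (Set.Ioo (0:ℝ) 1)) :
    ∫ q in (0:ℝ)..1, (f q + f (1 - q)) = 2 * ∫ q in (0:ℝ)..1, f q := by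
  have h1 : IntervalIntegrable f volume 0 1 :=
    (intervalIntegrable_iff_integrableOn_Ioo_of_le zero_le_one).mpr hf
  have h2 : IntervalIntegrable (fun q => f (1 - q)) volume 0 1 := by
    simpa using (h1.comp_sub_left 1).symm
  rw [intervalIntegral.integral_add h1 h2, intervalIntegral.integral_comp_sub_left]
  simp only [sub_self, sub_zero]
  ring

theorem tendsto_I_AB {p n : ℕ} (hp : Odd p) (hn0 : n ≠ 0) (hne : Even n) :
    Tendsto (fun N : ℕ => -(2 * π * ((p + 1).factorial / (2 * π) ^ (p + 1)) *
        Real.cos (π * (p + 1 : ℕ) / 2)) * ∑ k ∈ Finset.range N, (1 / ((k : ℝ) + 1) ^ (p + 1) *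
      (π * ((-1) ^ (n / 2) * (n.factorial / (2 * π) ^ n)) *
        ∑ j ∈ Finset.range (k + 1), (1 / ((j : ℝ) + 1) ^ n + 1 / (j : ℝ) ^ n)))) atTop
      (𝓝 (2 * π * ((p + 1 : ℕ) * I_AB p n + n * I_AB (p + 1) (n - 1)))) := by
  have hp0 : p ≠ 0 := by rintro rfl; simp at hp
  have hp1 : Even (p + 1) := hp.add_one
  set c := -(2 * π * ((p + 1).factorial / (2 * π) ^ (p + 1)) * Real.cos (π * (p + 1 : ℕ) / 2)) with hc
  set C : ℕ → ℝ → ℝ := fun N q =>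
    ∑ j ∈ Finset.range N, Real.cos (2 * π * ((j:ℝ) + 1) * q) * (1 / ((j : ℝ) + 1) ^ p) with hC
  set S : ℕ → ℝ → ℝ := fun N q =>
    ∑ j ∈ Finset.range N, Real.sin (2 * π * ((j:ℝ) + 1) * q) * (1 / ((j : ℝ) + 1) ^ (p + 1)) with hS
  have hB := continuous_B n
  have hB' := continuous_B (n - 1)
  have hcC : c * (2 * π) = (p + 1 : ℕ) *
      (2 * π * (p.factorial / (2 * π) ^ p) * Real.sin (π * p / 2)) := by
    have : Real.cos (π * (p + 1 : ℕ) / 2) = - Real.sin (π * p / 2) := by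
      rw [← Real.cos_add_pi_div_two]; congr 1; push_cast; ring
    rw [hc, this, Nat.factorial_succ, pow_succ]
    push_cast
    field_simp
  have hA1 := (integrableOn_A_mul_B_mul_K hp0 n).const_mul ((p + 1 : ℕ) : ℝ)
  have hA2 := (integrableOn_A_mul_B_mul_K (k := p + 1) p.succ_ne_zero (n - 1)).const_mul (n : ℝ)
  have hlim : 2 * π * ((p + 1 : ℕ) * I_AB p n + n * I_AB (p + 1) (n - 1)) =
      ∫ q in (0:ℝ)..1, ((p + 1 : ℕ) * (A p q + A p (1 - q)) * B n q +
        n * (A (p + 1) q - A (p + 1) (1 - q)) * B (n - 1) q) * K q := by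
    have h := integral_symm (hA1.add hA2)
    have h1 : IntervalIntegrable (fun q => ((p + 1 : ℕ) : ℝ) * (A p q * B n q * K q)) volume 0 1 :=
      (intervalIntegrable_iff_integrableOn_Ioo_of_le zero_le_one).mpr hA1
    have h2 : IntervalIntegrable (fun q => (n : ℝ) * (A (p + 1) q * B (n - 1) q * K q)) volume 0 1 :=
      (intervalIntegrable_iff_integrableOn_Ioo_of_le zero_le_one).mpr hA2
    simp only [Pi.add_apply] at h
    rw [intervalIntegral.integral_add h1 h2, intervalIntegral.integral_const_mul,
      intervalIntegral.integral_const_mul] at h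
    have e : 2 * π * ((p + 1 : ℕ) * I_AB p n + n * I_AB (p + 1) (n - 1)) =
        2 * (((p + 1 : ℕ) : ℝ) * (∫ q in (0:ℝ)..1, A p q * B n q * K q) +
          n * ∫ q in (0:ℝ)..1, A (p + 1) q * B (n - 1) q * K q) := by
      rw [I_AB, I_AB]
      field_simp
    rw [e, ← h]
    refine intervalIntegral.integral_congr fun q _ => ?_
    have hodd : Odd (n - 1) := Nat.Even.sub_odd (Nat.one_le_iff_ne_zero.mpr hn0) hne odd_one
    simp only [B_one_sub, K_one_sub, hne.neg_one_pow, hodd.neg_one_pow]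
    ring
  rw [hlim]
  have hN (N : ℕ) : c * ∑ k ∈ Finset.range N, (1 / ((k : ℝ) + 1) ^ (p + 1) *
      (π * ((-1) ^ (n / 2) * (n.factorial / (2 * π) ^ n)) *
        ∑ j ∈ Finset.range (k + 1), (1 / ((j : ℝ) + 1) ^ n + 1 / (j : ℝ) ^ n))) =
      ∫ q in (0:ℝ)..1, (c * (2 * π) * C N q * B n q + n * (c * S N q) * B (n - 1) q) * K q := by
    simp_rw [← integral_deriv_sin_mul_B_mul_K hn0 hne, ← intervalIntegral.integral_const_mul]
    rw [← intervalIntegral.integral_finsetSum fun j _ => (intervalIntegrable_K.continuousOn_mul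
      (Continuous.continuousOn (by fun_prop))).const_mul _, ← intervalIntegral.integral_const_mul]
    refine intervalIntegral.integral_congr fun q _ => ?_
    simp only [hC, hS, Finset.mul_sum, Finset.sum_mul, add_mul]
    rw [← Finset.sum_add_distrib]
    refine Finset.sum_congr rfl fun k _ => ?_
    have : ((k : ℝ) + 1) ≠ 0 := by positivity
    push_cast
    rw [pow_succ]
    field_simp
  simp_rw [hN]
  obtain ⟨b, hb⟩ := (isCompact_Icc (a := (0:ℝ)) (b := 1)).exists_bound_of_continuousOn
    hB.continuousOn
  obtain ⟨b', hb'⟩ := (isCompact_Icc (a := (0:ℝ)) (b := 1)).exists_bound_of_continuousOn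
    hB'.continuousOn
  set Z : ℕ → ℝ := fun k => 1 + k * ∑' i : ℕ, ((i : ℝ) + 1) ^ (-(5 / 4) : ℝ) with hZ
  simp only [intervalIntegral.integral_of_le zero_le_one, integral_Ioc_eq_integral_Ioo]
  refine tendsto_integral_of_dominated_convergence
    (fun q => (|c * (2 * π)| * Z p * b + n * (|c| * Z (p + 1)) * b') *
      (1 / √(Real.sin (π * q)) * |K q|)) (fun N => ?_) (integrableOn_K_div_sqrt.const_mul _)
    (fun N => (ae_restrict_mem measurableSet_Ioo).mono fun q hq => ?_)
    ((ae_restrict_mem measurableSet_Ioo).mono fun q hq => ?_)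
  · exact (Continuous.aestronglyMeasurable (by fun_prop)).mul measurable_K.aestronglyMeasurable
  · have h1 := (abs_sum_cos_sin_le hq hp0 N).1
    have h2 := (abs_sum_cos_sin_le hq p.succ_ne_zero N).2
    have h3 := hb q (Set.Ioo_subset_Icc_self hq)
    have h4 := hb' q (Set.Ioo_subset_Icc_self hq)
    have p1 := (abs_nonneg _).trans h1
    have p2 := (abs_nonneg _).trans h2
    rw [norm_mul]
    calc _ ≤ (|c * (2 * π)| * (Z p / √(Real.sin (π * q))) * b +
          n * (|c| * (Z (p + 1) / √(Real.sin (π * q)))) * b') * |K q| := by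
          refine mul_le_mul_of_nonneg_right ((norm_add_le _ _).trans ?_) (abs_nonneg _)
          rw [norm_mul (c * (2 * π) * C N q), norm_mul (c * (2 * π)), norm_mul (n * (c * S N q)),
            norm_mul (n : ℝ), norm_mul c (S N q),
            Real.norm_of_nonneg (Nat.cast_nonneg n)]
          refine add_le_add ?_ ?_
          · exact mul_le_mul (mul_le_mul_of_nonneg_left h1 (abs_nonneg _)) h3 (norm_nonneg _)
              (mul_nonneg (abs_nonneg _) p1)
          · exact mul_le_mul (mul_le_mul_of_nonneg_left (mul_le_mul_of_nonneg_left h2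
              (abs_nonneg _)) (Nat.cast_nonneg n)) h4 (norm_nonneg _)
              (mul_nonneg (Nat.cast_nonneg n) (mul_nonneg (abs_nonneg _) p2))
      _ = _ := by ring
  · have h1 := (tendsto_A_add hq hp).const_mul ((p + 1 : ℕ) : ℝ)
    simp_rw [← mul_assoc _ _ (∑ j ∈ Finset.range _, _)] at h1
    have h2 := tendsto_A_sub hq p.succ_ne_zero hp1
    refine (((?_ : Tendsto (fun N => c * (2 * π) * C N q) atTop _).mul_const _).add
      (((h2.const_mul (n : ℝ))).mul_const _)).mul_const _
    rw [hcC]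
    exact h1

theorem rzeta_eq_tsum {k : ℕ} (hk : 2 ≤ k) : rzeta k = ∑' j : ℕ, 1 / ((j : ℝ) + 1) ^ k := by
  have h : 1 < ((k : ℝ) : ℂ).re := by
    rw [Complex.ofReal_re]; exact_mod_cast hk
  rw [rzeta, zeta_eq_tsum_one_div_nat_add_one_cpow h]
  rw [← Complex.ofReal_re (∑' j : ℕ, 1 / ((j : ℝ) + 1) ^ k), Complex.ofReal_tsum]
  congr 1
  refine tsum_congr fun j => ?_
  rw [Complex.ofReal_natCast, Complex.cpow_natCast]
  push_cast
  rfl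

theorem summable_one_div_add_one_pow {k : ℕ} (hk : 2 ≤ k) :
    Summable fun j : ℕ => 1 / ((j : ℝ) + 1) ^ k := by
  have := (summable_nat_add_iff 1).mpr (Real.summable_one_div_nat_pow (p := k).mpr (by omega))
  simpa using this

theorem T_zero_eq_tsum {m n : ℕ} (hn : 2 ≤ n) :
    T m 0 n = ∑' r : ℕ, 1 / ((r : ℝ) + 1) ^ m *
      (rzeta n - ∑ j ∈ Finset.range (r + 1), 1 / ((j : ℝ) + 1) ^ n) := by
  rw [T, tsum_pnat_eq_tsum_succ (f := fun r : ℕ => ∑' s : ℕ+,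
    1 / ((r : ℝ) ^ (m : ℝ) * (s : ℝ) ^ (0 : ℝ) * ((r : ℝ) + (s : ℝ)) ^ (n : ℝ)))]
  refine tsum_congr fun r => ?_
  rw [tsum_pnat_eq_tsum_succ (f := fun s : ℕ =>
    1 / (((r + 1 : ℕ) : ℝ) ^ (m : ℝ) * (s : ℝ) ^ (0 : ℝ) * (((r + 1 : ℕ) : ℝ) + (s : ℝ)) ^ (n : ℝ))),
    rzeta_eq_tsum hn, ← (summable_one_div_add_one_pow hn).sum_add_tsum_nat_add (r + 1),
    add_sub_cancel_left, ← tsum_mul_left]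
  refine tsum_congr fun s => ?_
  rw [Real.rpow_natCast, Real.rpow_natCast, Real.rpow_zero, mul_one, one_div_mul_one_div]
  push_cast
  congr 3
  ring

end Auxiliary

theorem tornheim_T_m_0_n_even_even (m n : ℕ) (hm : 2 ≤ m) (hn : 2 ≤ n)
    (hme : Even m) (hne : Even n) :
    T m 0 n = rzeta m * rzeta n - (1 / 2) * rzeta (m + n) +
      (-1 : ℝ) ^ ((m + n) / 2) * ((2 * π) ^ (m + n - 1) / (m.factorial * n.factorial)) *
        (m * I_AB (m - 1) n + n * I_AB m (n - 1)) := by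
  set H : ℕ → ℝ := fun r => ∑ j ∈ Finset.range (r + 1), 1 / ((j : ℝ) + 1) ^ n with hH
  have hsm := summable_one_div_add_one_pow hm
  have hsn := summable_one_div_add_one_pow hn
  have hsmn := summable_one_div_add_one_pow (k := m + n) (by omega)
  have hS : Summable fun r : ℕ => 1 / ((r : ℝ) + 1) ^ m * H r := by
    refine Summable.of_nonneg_of_le (fun r => ?_) (fun r => ?_)
      (hsm.mul_right (∑' j : ℕ, 1 / ((j : ℝ) + 1) ^ n))
    · have : 0 ≤ H r := Finset.sum_nonneg fun _ _ => by positivity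
      positivity
    · gcongr
      exact hsn.sum_le_tsum _ fun _ _ => by positivity
  have hT : T m 0 n = rzeta m * rzeta n - ∑' r : ℕ, 1 / ((r : ℝ) + 1) ^ m * H r := by
    rw [T_zero_eq_tsum hn]
    simp_rw [mul_sub]
    rw [(hsm.mul_right _).tsum_sub hS, tsum_mul_right, ← rzeta_eq_tsum hm]
  obtain ⟨p, rfl⟩ : ∃ p, m = p + 1 := ⟨m - 1, by omega⟩
  have hp : Odd p := by
    rcases Nat.even_or_odd p with h | h
    · exact absurd hme (Nat.not_even_iff_odd.mpr h.add_one)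
    · exact h
  have hlim := tendsto_I_AB hp (by omega : n ≠ 0) hne
  have hH2 (k : ℕ) : ∑ j ∈ Finset.range (k + 1), (1 / ((j : ℝ) + 1) ^ n + 1 / (j : ℝ) ^ n) =
      2 * H k - 1 / ((k : ℝ) + 1) ^ n := by
    have h1 : ∑ j ∈ Finset.range (k + 1), 1 / (j : ℝ) ^ n =
        ∑ j ∈ Finset.range k, 1 / ((j : ℝ) + 1) ^ n := by
      rw [Finset.sum_range_succ']
      simp [show n ≠ 0 by omega]
    have h2 : H k = ∑ j ∈ Finset.range k, 1 / ((j : ℝ) + 1) ^ n + 1 / ((k : ℝ) + 1) ^ n :=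
      Finset.sum_range_succ _ _
    rw [Finset.sum_add_distrib, h1]
    change H k + _ = _
    linarith
  have hsum := ((hS.hasSum.mul_left 2).sub hsmn.hasSum).mul_left
    (π * ((-1) ^ (n / 2) * (n.factorial / (2 * π) ^ n)))
  have hval := tendsto_nhds_unique hlim ((hsum.tendsto_sum_nat.const_mul
    (-(2 * π * ((p + 1).factorial / (2 * π) ^ (p + 1)) * Real.cos (π * (p + 1 : ℕ) / 2)))).congr
      fun N => by
        congr 1
        refine Finset.sum_congr rfl fun k _ => ?_
        rw [hH2, pow_add _ (p + 1) n, ← one_div_mul_one_div]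
        ring)
  have hzmn : rzeta ((p + 1 : ℕ) + n) = ∑' j : ℕ, 1 / ((j : ℝ) + 1) ^ (p + 1 + n) := by
    rw [← rzeta_eq_tsum (by omega : 2 ≤ p + 1 + n)]
    push_cast
    rfl
  rw [← hzmn] at hval
  have hcos : Real.cos (π * (p + 1 : ℕ) / 2) = (-1) ^ ((p + 1) / 2) := by
    obtain ⟨r, hr⟩ := hme
    rw [hr, show (r + r) / 2 = r by omega, show π * (r + r : ℕ) / 2 = r * π by push_cast; ring,
      Real.cos_nat_mul_pi]
  have hsign : (-1 : ℝ) ^ ((p + 1 + n) / 2) = (-1) ^ ((p + 1) / 2) * (-1) ^ (n / 2) := by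
    obtain ⟨r, hr⟩ := hme
    obtain ⟨t, rfl⟩ := hne
    rw [hr, ← pow_add]
    congr 1
    omega
  rw [hcos] at hval
  rw [hT, hsign, Nat.add_sub_cancel]
  set X := ((p + 1 : ℕ) : ℝ) * I_AB p n + n * I_AB (p + 1) (n - 1) with hX
  have hXv : X = -((p + 1).factorial / (2 * π) ^ (p + 1) * (-1) ^ ((p + 1) / 2)) *
      (π * ((-1) ^ (n / 2) * (n.factorial / (2 * π) ^ n)) *
        (2 * (∑' r : ℕ, 1 / ((r : ℝ) + 1) ^ (p + 1) * H r) - rzeta ((p + 1 : ℕ) + n))) := by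
    have : (2 * π) ≠ 0 := by positivity
    apply mul_left_cancel₀ this
    rw [hval]
    ring
  have hsq (a : ℕ) : ((-1 : ℝ) ^ a) * (-1) ^ a = 1 := by rw [← mul_pow]; norm_num
  rw [hXv, show p + 1 + n - 1 = p + n by omega]
  have f1 : ((p + 1).factorial : ℝ) ≠ 0 := by positivity
  have f2 : (n.factorial : ℝ) ≠ 0 := by positivity
  have key : (-1 : ℝ) ^ ((p + 1) / 2) * (-1) ^ (n / 2) *
      ((2 * π) ^ (p + n) / ((p + 1).factorial * n.factorial)) *
      (((p + 1).factorial / (2 * π) ^ (p + 1) * (-1) ^ ((p + 1) / 2)) *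
        (π * ((-1) ^ (n / 2) * (n.factorial / (2 * π) ^ n)))) = 1 / 2 := by
    calc _ = ((-1 : ℝ) ^ ((p + 1) / 2) * (-1) ^ ((p + 1) / 2)) * ((-1) ^ (n / 2) * (-1) ^ (n / 2)) *
        (((2 * π) ^ (p + n) / ((p + 1).factorial * n.factorial)) *
        (((p + 1).factorial / (2 * π) ^ (p + 1)) * (π * (n.factorial / (2 * π) ^ n)))) := by ring
      _ = _ := by
        rw [hsq, hsq, pow_succ, pow_add]
        field_simp
  linear_combination (2 * (∑' r : ℕ, 1 / ((r : ℝ) + 1) ^ (p + 1) * H r) -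
    rzeta ((p + 1 : ℕ) + n)) * key
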